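/- If M is a Hausdorff MT-algebra, then every compact element of M is closed, i.e., K(M) ⊆ C(M). -/

import Mathlib

/-- An MT-algebra: a complete Boolean algebra with an interior operator. -/
structure MTAlg (M : Type*) [CompleteBooleanAlgebra M] where
  box : M → M
  box_top : box ⊤ = ⊤
  box_inf : ∀ a b : M, box (a ⊓ b) = box a ⊓ box b
  box_le : ∀ a : M, box a ≤ a
  box_idem : ∀ a : M, box a ≤ box (box a)

namespace MTAlg

variable {M : Type*} [CompleteBooleanAlgebra M] (T : MTAlg M)

/-- The closure (dual) operator. -/
def dia (a : M) : M := (T.box aᶜ)ᶜ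

/-- Open elements. -/
def IsOpenElem (a : M) : Prop := T.box a = a

/-- Closed elements. -/
def IsClosedElem (a : M) : Prop := T.dia a = a

/-- Saturated elements: meets of open elements. -/
def IsSaturatedElem (a : M) : Prop :=
  ∃ S : Set M, (∀ s ∈ S, T.IsOpenElem s) ∧ a = sInf S

/-- Weakly locally closed elements: meets of a saturated and a closed element. -/
def IsWLC (a : M) : Prop :=
  ∃ s c : M, T.IsSaturatedElem s ∧ T.IsClosedElem c ∧ a = s ⊓ c

/-- T0-algebras: every element is a join of weakly locally closed elements. -/
def IsT0 : Prop :=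
  ∀ a : M, ∃ S : Set M, (∀ b ∈ S, T.IsWLC b) ∧ a = sSup S

/-- T1-algebras: every element is a join of closed elements. -/
def IsT1 : Prop :=
  ∀ a : M, ∃ S : Set M, (∀ b ∈ S, T.IsClosedElem b) ∧ a = sSup S

/-- Join-irreducible elements of the lattice of closed elements. -/
def JoinIrredClosed (p : M) : Prop :=
  T.IsClosedElem p ∧ p ≠ ⊥ ∧
    ∀ a b : M, T.IsClosedElem a → T.IsClosedElem b → p = a ⊔ b → p = a ∨ p = b

/-- Sober MT-algebras. -/
def Sober : Prop :=
  T.IsT0 ∧ ∀ p : M, T.JoinIrredClosed p → ∃ x : M, IsAtom x ∧ p = T.dia x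

/-- Filters of the underlying lattice. -/
def IsFilter (F : Set M) : Prop :=
  ⊤ ∈ F ∧ (∀ a b : M, a ∈ F → a ≤ b → b ∈ F) ∧ (∀ a b : M, a ∈ F → b ∈ F → a ⊓ b ∈ F)

/-- Open filters. -/
def IsOpenFilter (F : Set M) : Prop :=
  IsFilter F ∧ ∀ a ∈ F, T.box a ∈ F

/-- Scott-open filters. -/
def IsScottOpenFilter (F : Set M) : Prop :=
  T.IsOpenFilter F ∧
    ∀ S : Set M, (∀ s ∈ S, T.IsOpenElem s) → S.Nonempty → DirectedOn (· ≤ ·) S →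
      sSup S ∈ F → ∃ s ∈ S, s ∈ F

/-- Compact elements. -/
def IsCompactElem (a : M) : Prop :=
  ∀ S : Set M, (∀ s ∈ S, T.IsOpenElem s) → a ≤ sSup S →
    ∃ t ⊆ S, t.Finite ∧ a ≤ sSup t

/-- The relation `a ◁ b`: there is a compact element between `a` and `b`. -/
def Triangle (a b : M) : Prop := ∃ k : M, T.IsCompactElem k ∧ a ≤ k ∧ k ≤ b

/-- Locally compact MT-algebras. -/
def LocallyCompact : Prop :=
  ∀ u : M, T.IsOpenElem u → u = sSup {v : M | T.IsOpenElem v ∧ T.Triangle v u}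

/-- The way-below relation in the frame of open elements. -/
def WayBelowOpen (a b : M) : Prop :=
  ∀ S : Set M, (∀ s ∈ S, T.IsOpenElem s) → b ≤ sSup S →
    ∃ t ⊆ S, t.Finite ∧ a ≤ sSup t

/-- Elements approximated from above by regular closed elements. -/
def GC (a : M) : Prop :=
  a = sInf {b : M | ∃ c : M, a ≤ T.box c ∧ b = T.dia (T.box c)}

/-- Hausdorff MT-algebras. -/
def IsHausdorff : Prop :=
  ∀ a : M, ∃ S : Set M, (∀ b ∈ S, T.GC b) ∧ a = sSup S

/-- Regular MT-algebras. -/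
def IsRegular : Prop :=
  T.IsT1 ∧ ∀ a : M, T.IsOpenElem a →
    a = sSup {b : M | T.IsOpenElem b ∧ T.dia b ≤ a}

end MTAlg

/-- The atom space of a complete Boolean algebra. -/
abbrev AtomSpace (M : Type*) [CompleteBooleanAlgebra M] : Type _ := {x : M // IsAtom x}

/-- The set of atoms below an element. -/
def eta {M : Type*} [CompleteBooleanAlgebra M] (a : M) : Set (AtomSpace M) :=
  {x : AtomSpace M | x.1 ≤ a}

namespace MTAlg

variable {M : Type*} [CompleteBooleanAlgebra M] (T : MTAlg M)

/-- The topology on the atom space, generated by the images of open elements. -/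
def atTop : TopologicalSpace (AtomSpace M) :=
  TopologicalSpace.generateFrom {U : Set (AtomSpace M) | ∃ u : M, T.IsOpenElem u ∧ U = eta u}

end MTAlg

namespace MTAlg

variable {M : Type*} [CompleteBooleanAlgebra M] (T : MTAlg M)

theorem box_box (a : M) : T.box (T.box a) = T.box a :=
  le_antisymm (T.box_le _) (T.box_idem a)

theorem box_mono {a b : M} (h : a ≤ b) : T.box a ≤ T.box b := by
  rw [← inf_eq_left, ← T.box_inf, inf_eq_left.2 h]

theorem le_dia (a : M) : a ≤ T.dia a :=
  le_compl_comm.1 (T.box_le aᶜ)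

/-- An open element disjoint from `a` is disjoint from the closure of `a`. -/
theorem IsOpenElem.disjoint_dia {T : MTAlg M} {u a : M} (hu : T.IsOpenElem u)
    (h : Disjoint u a) : Disjoint u (T.dia a) := by
  rw [dia, disjoint_compl_right_iff, ← hu]
  exact T.box_mono h.le_compl_right

/-- Finitely many elements, each separated from `b` by an open element above `b`, are
simultaneously separated from `b`. -/
theorem exists_isOpenElem_disjoint_sSup {b : M} {t : Set M} (ht : t.Finite)
    (h : ∀ s ∈ t, ∃ u, T.IsOpenElem u ∧ b ≤ u ∧ Disjoint u s) :
    ∃ u, T.IsOpenElem u ∧ b ≤ u ∧ Disjoint u (sSup t) := by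
  induction t, ht using Set.Finite.induction_on with
  | empty => exact ⟨⊤, T.box_top, le_top, by simp⟩
  | @insert s t _ _ ih =>
    obtain ⟨u, hu, hbu, hd⟩ := ih fun s hs => h s (Set.mem_insert_of_mem _ hs)
    obtain ⟨v, hv, hbv, hs⟩ := h s (Set.mem_insert _ _)
    refine ⟨v ⊓ u, (T.box_inf v u).trans (congrArg₂ (· ⊓ ·) hv hu), le_inf hbv hbu, ?_⟩
    rw [sSup_insert]
    exact (hs.mono_left inf_le_left).sup_right (hd.mono_left inf_le_right)

/-- A compact element disjoint from an element `b` satisfying `GC` has closure disjoint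
from `b`. -/
theorem IsCompactElem.disjoint_dia {T : MTAlg M} {a b : M} (ha : T.IsCompactElem a)
    (hb : T.GC b) (h : Disjoint b a) : Disjoint b (T.dia a) := by
  let S : Set M := {s | ∃ c, b ≤ T.box c ∧ s = T.box (T.box c)ᶜ}
  have hS : bᶜ ≤ sSup S := by
    rw [compl_le_iff_compl_le, hb]
    refine le_sInf ?_
    rintro _ ⟨c, hc, rfl⟩
    exact compl_le_compl (le_sSup ⟨c, hc, rfl⟩)
  obtain ⟨t, htS, ht, hat⟩ := ha S
    (by rintro _ ⟨c, -, rfl⟩; exact T.box_box _) (h.symm.le_compl_right.trans hS)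
  obtain ⟨u, hu, hbu, hd⟩ := T.exists_isOpenElem_disjoint_sSup (b := b) ht fun s hs => by
    obtain ⟨c, hc, rfl⟩ := htS hs
    exact ⟨T.box c, T.box_box c, hc, disjoint_compl_right.mono_right (T.box_le _)⟩
  exact (hu.disjoint_dia (hd.mono_right hat)).mono_left hbu

end MTAlg

/-- In a Hausdorff MT-algebra every compact element is closed. -/
theorem compact_le_closed_of_hausdorff {M : Type*} [CompleteBooleanAlgebra M]
    (T : MTAlg M) (hT2 : T.IsHausdorff) :
    ∀ a : M, T.IsCompactElem a → T.IsClosedElem a := by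
  intro a ha
  obtain ⟨S, hS, haS⟩ := hT2 aᶜ
  refine le_antisymm ?_ (T.le_dia a)
  rw [← disjoint_compl_left_iff, haS, sSup_disjoint_iff]
  intro b hb
  exact ha.disjoint_dia (hS b hb) (le_compl_iff_disjoint_right.1 (haS ▸ le_sSup hb))
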